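/- Let d ≥ 1, T > 0, and let G : P_2(ℝ^d) → ℝ be bounded from below and satisfy, for some C_G > 0, |G(m²) − G(m¹)| ≤ C_G (1 + M_2(m¹) + M_2(m²)) d_2(m¹,m²) for all m¹, m² ∈ P_2(ℝ^d). Fix t ∈ [0,T) and m ∈ P_2(ℝ^d), and let (x^N)_{N≥1} with x^N ∈ (ℝ^d)^N satisfy d_2(m^N_{x^N}, m) → 0 as N → ∞. Then lim_{N→∞} V^N(t, x^N) = U(t, m). -/

import Mathlib

open MeasureTheory Filter
open scoped ENNReal NNReal BigOperators

noncomputable section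

/-- `Ed d` is the Euclidean space `ℝ^d`. -/
abbrev Ed (d : ℕ) := EuclideanSpace ℝ (Fin d)

/-- A Borel probability measure on `ℝ^d` with finite second moment,
i.e. an element of `P_2(ℝ^d)`. -/
def IsP2 {d : ℕ} (μ : Measure (Ed d)) : Prop :=
  IsProbabilityMeasure μ ∧ Integrable (fun x => ‖x‖ ^ 2) μ

/-- The empirical measure `m_x^N = (1/N) ∑ δ_{x^i}`. -/
def empMeas {d N : ℕ} (x : Fin N → Ed d) : Measure (Ed d) :=
  (N : ℝ≥0∞)⁻¹ • ∑ i, Measure.dirac (x i)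

/-- `π` is a coupling of `μ` and `ν`. -/
def IsCoupling {d : ℕ} (π : Measure (Ed d × Ed d)) (μ ν : Measure (Ed d)) : Prop :=
  IsProbabilityMeasure π ∧ π.map Prod.fst = μ ∧ π.map Prod.snd = ν

/-- The squared 2-Wasserstein distance `d_2(μ,ν)²`, as the infimum over couplings of
`∫ |x - y|² dπ(x,y)` (with value in `[0,∞]`). -/
def d2sq {d : ℕ} (μ ν : Measure (Ed d)) : ℝ≥0∞ :=
  ⨅ (π : Measure (Ed d × Ed d)) (_ : IsCoupling π μ ν),
    ∫⁻ p, (‖p.1 - p.2‖₊ : ℝ≥0∞) ^ 2 ∂π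

/-- The 2-Wasserstein distance `d_2(μ,ν)`. -/
def d2 {d : ℕ} (μ ν : Measure (Ed d)) : ℝ := Real.sqrt (d2sq μ ν).toReal

/-- The 1-Wasserstein distance, via Kantorovich duality:
`d_1(μ,ν) = sup { ∫ f dμ - ∫ f dν : f 1-Lipschitz }`. -/
def d1 {d : ℕ} (μ ν : Measure (Ed d)) : ℝ :=
  sSup { r | ∃ f : Ed d → ℝ, LipschitzWith 1 f ∧ r = (∫ x, f x ∂μ) - ∫ x, f x ∂ν }

/-- The Hopf–Lax mean-field value function
`U(t,m) = inf_{ν ∈ P_2} { G(ν) + d_2(m,ν)²/(2(T-t)) }`. -/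
def MFval {d : ℕ} (T : ℝ) (G : Measure (Ed d) → ℝ) (t : ℝ) (m : Measure (Ed d)) : ℝ :=
  sInf { r | ∃ ν : Measure (Ed d), IsP2 ν ∧
    r = G ν + (d2sq m ν).toReal / (2 * (T - t)) }

/-- The Hopf–Lax `N`-particle value function
`V^N(t,x) = inf_y { G(m_y^N) + (1/(2(T-t)N)) ∑ |x^i - y^i|² }`. -/
def NPval {d N : ℕ} (T : ℝ) (G : Measure (Ed d) → ℝ) (t : ℝ) (x : Fin N → Ed d) : ℝ :=
  sInf { r | ∃ y : Fin N → Ed d,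
    r = G (empMeas y) + (1 / (2 * (T - t) * (N : ℝ))) * ∑ i, ‖x i - y i‖ ^ 2 }

/-- The second moment `M_2(ν) = (∫ |x|² dν)^{1/2}`. -/
def M2 {d : ℕ} (ν : Measure (Ed d)) : ℝ := Real.sqrt (∫ x, ‖x‖ ^ 2 ∂ν)

section Coupling

variable {d : ℕ} {μ ν ρ : Measure (Ed d)} {π : Measure (Ed d × Ed d)}

lemma IsCoupling.of_map [IsProbabilityMeasure μ] (h₁ : π.map Prod.fst = μ)
    (h₂ : π.map Prod.snd = ν) : IsCoupling π μ ν := by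
  refine ⟨⟨?_⟩, h₁, h₂⟩
  have h := measure_univ (μ := μ)
  rwa [← h₁, Measure.map_apply measurable_fst MeasurableSet.univ, Set.preimage_univ] at h

lemma IsCoupling.swap (h : IsCoupling π μ ν) : IsCoupling (π.map Prod.swap) ν μ := by
  obtain ⟨hπ, h₁, h₂⟩ := h
  refine ⟨Measure.isProbabilityMeasure_map measurable_swap.aemeasurable, ?_, ?_⟩
  · rw [Measure.map_map measurable_fst measurable_swap]; exact h₂
  · rw [Measure.map_map measurable_snd measurable_swap]; exact h₁

lemma IsCoupling.d2sq_le (h : IsCoupling π μ ν) :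
    d2sq μ ν ≤ ∫⁻ p, (‖p.1 - p.2‖₊ : ℝ≥0∞) ^ 2 ∂π :=
  iInf₂_le π h

lemma d2sq_comm (μ ν : Measure (Ed d)) : d2sq μ ν = d2sq ν μ := by
  suffices H : ∀ μ ν : Measure (Ed d), d2sq ν μ ≤ d2sq μ ν from le_antisymm (H _ _) (H _ _)
  refine fun μ ν => le_iInf₂ fun π hπ => hπ.swap.d2sq_le.trans_eq ?_
  rw [lintegral_map (by fun_prop) measurable_swap]
  simp only [Prod.fst_swap, Prod.snd_swap, ← enorm_eq_nnnorm]
  exact lintegral_congr fun p => by rw [enorm_sub_rev]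

lemma d2_comm (μ ν : Measure (Ed d)) : d2 μ ν = d2 ν μ := by
  rw [d2, d2, d2sq_comm]

lemma d2_nonneg (μ ν : Measure (Ed d)) : 0 ≤ d2 μ ν := Real.sqrt_nonneg _

lemma d2_sq (μ ν : Measure (Ed d)) : d2 μ ν ^ 2 = (d2sq μ ν).toReal :=
  Real.sq_sqrt ENNReal.toReal_nonneg

lemma add_sq_le_weighted (u v : ℝ) {a b : ℝ} (ha : 0 < a) (hb : 0 < b) :
    (u + v) ^ 2 ≤ (1 + b / a) * u ^ 2 + (1 + a / b) * v ^ 2 := by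
  have h : (1 + b / a) * u ^ 2 + (1 + a / b) * v ^ 2 - (u + v) ^ 2
      = (b * u - a * v) ^ 2 / (a * b) := by
    field_simp
    ring
  have : 0 ≤ (b * u - a * v) ^ 2 / (a * b) := by positivity
  linarith

lemma nnnorm_sub_sq_le_weighted (x y z : Ed d) {a b : ℝ} (ha : 0 < a) (hb : 0 < b) :
    (‖x - z‖₊ : ℝ≥0∞) ^ 2 ≤ ENNReal.ofReal (1 + b / a) * (‖x - y‖₊ : ℝ≥0∞) ^ 2
      + ENNReal.ofReal (1 + a / b) * (‖y - z‖₊ : ℝ≥0∞) ^ 2 := by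
  simp only [← enorm_eq_nnnorm, ← ofReal_norm]
  rw [← ENNReal.ofReal_pow (norm_nonneg _), ← ENNReal.ofReal_pow (norm_nonneg _),
    ← ENNReal.ofReal_pow (norm_nonneg _), ← ENNReal.ofReal_mul (by positivity),
    ← ENNReal.ofReal_mul (by positivity), ← ENNReal.ofReal_add (by positivity) (by positivity)]
  refine ENNReal.ofReal_le_ofReal (le_trans ?_ (add_sq_le_weighted _ _ ha hb))
  gcongr
  exact norm_sub_le_norm_sub_add_norm_sub x y z

/-- The gluing lemma. -/
lemma exists_gluing {π₁ π₂ : Measure (Ed d × Ed d)} (h₁ : IsCoupling π₁ μ ν)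
    (h₂ : IsCoupling π₂ ν ρ) :
    ∃ γ : Measure ((Ed d × Ed d) × Ed d), IsProbabilityMeasure γ ∧ γ.map Prod.fst = π₁ ∧
      γ.map (fun q => (q.1.2, q.2)) = π₂ := by
  obtain ⟨hp₁, -, hs₁⟩ := h₁
  obtain ⟨hp₂, hf₂, -⟩ := h₂
  refine ⟨π₁.compProd (π₂.condKernel.comap Prod.snd measurable_snd), inferInstance, ?_, ?_⟩
  · exact Measure.fst_compProd _ _
  · ext s hs
    rw [Measure.map_apply (by fun_prop) hs, Measure.compProd_apply (by measurability)]
    conv_rhs => rw [← π₂.disintegrate π₂.condKernel, Measure.compProd_apply hs, Measure.fst,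
      hf₂, ← hs₁, lintegral_map (ProbabilityTheory.Kernel.measurable_kernel_prodMk_left hs)
        measurable_snd]
    rfl

lemma d2sq_le_weighted (μ ν ρ : Measure (Ed d)) {a b : ℝ} (ha : 0 < a) (hb : 0 < b) :
    d2sq μ ρ ≤ ENNReal.ofReal (1 + b / a) * d2sq μ ν
      + ENNReal.ofReal (1 + a / b) * d2sq ν ρ := by
  have hA : ENNReal.ofReal (1 + b / a) ≠ 0 := by
    rw [ne_eq, ENNReal.ofReal_eq_zero, not_le]; positivity
  have hB : ENNReal.ofReal (1 + a / b) ≠ 0 := by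
    rw [ne_eq, ENNReal.ofReal_eq_zero, not_le]; positivity
  have key : ∀ π₁ π₂ : Measure (Ed d × Ed d), IsCoupling π₁ μ ν → IsCoupling π₂ ν ρ →
      d2sq μ ρ ≤ ENNReal.ofReal (1 + b / a) * ∫⁻ p, (‖p.1 - p.2‖₊ : ℝ≥0∞) ^ 2 ∂π₁
        + ENNReal.ofReal (1 + a / b) * ∫⁻ p, (‖p.1 - p.2‖₊ : ℝ≥0∞) ^ 2 ∂π₂ := by
    intro π₁ π₂ h₁ h₂
    obtain ⟨γ, hγ, hγ₁, hγ₂⟩ := exists_gluing h₁ h₂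
    have hc : IsCoupling (γ.map fun q => (q.1.1, q.2)) μ ρ := by
      refine ⟨Measure.isProbabilityMeasure_map (by fun_prop), ?_, ?_⟩
      · rw [← h₁.2.1, ← hγ₁, Measure.map_map (by fun_prop) (by fun_prop),
          Measure.map_map (by fun_prop) (by fun_prop)]; rfl
      · rw [← h₂.2.2, ← hγ₂, Measure.map_map (by fun_prop) (by fun_prop),
          Measure.map_map (by fun_prop) (by fun_prop)]; rfl
    refine hc.d2sq_le.trans ?_
    rw [lintegral_map (by fun_prop) (by fun_prop), ← hγ₁, ← hγ₂,
      lintegral_map (by fun_prop) (by fun_prop), lintegral_map (by fun_prop) (by fun_prop),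
      ← lintegral_const_mul _ (by fun_prop), ← lintegral_const_mul _ (by fun_prop),
      ← lintegral_add_left (by fun_prop)]
    exact lintegral_mono fun q => nnnorm_sub_sq_le_weighted _ _ _ ha hb
  rw [d2sq.eq_def μ ν, d2sq.eq_def ν ρ]
  simp only [ENNReal.mul_iInf_of_ne hA ENNReal.ofReal_ne_top,
    ENNReal.mul_iInf_of_ne hB ENNReal.ofReal_ne_top, ENNReal.iInf_add, ENNReal.add_iInf]
  exact le_iInf₂ fun π₁ h₁ => le_iInf₂ fun π₂ h₂ => key _ _ (by assumption) (by assumption)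

lemma d2_triangle (h₁ : d2sq μ ν ≠ ⊤) (h₂ : d2sq ν ρ ≠ ⊤) : d2 μ ρ ≤ d2 μ ν + d2 ν ρ := by
  refine le_of_forall_pos_le_add fun ε hε => ?_
  set a := d2 μ ν + ε / 2 with ha_def
  set b := d2 ν ρ + ε / 2 with hb_def
  have ha : 0 < a := by have := d2_nonneg μ ν; positivity
  have hb : 0 < b := by have := d2_nonneg ν ρ; positivity
  have hA : (d2sq μ ν).toReal ≤ a ^ 2 := by
    rw [← d2_sq]; exact pow_le_pow_left₀ (d2_nonneg _ _) (by linarith) 2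
  have hB : (d2sq ν ρ).toReal ≤ b ^ 2 := by
    rw [← d2_sq]; exact pow_le_pow_left₀ (d2_nonneg _ _) (by linarith) 2
  have h := ENNReal.toReal_mono (by finiteness) (d2sq_le_weighted μ ν ρ ha hb)
  rw [ENNReal.toReal_add (by finiteness) (by finiteness), ENNReal.toReal_mul, ENNReal.toReal_mul,
    ENNReal.toReal_ofReal (by positivity), ENNReal.toReal_ofReal (by positivity)] at h
  have h' : (d2sq μ ρ).toReal ≤ (a + b) ^ 2 :=
    calc (d2sq μ ρ).toReal ≤ (1 + b / a) * a ^ 2 + (1 + a / b) * b ^ 2 := h.trans (by gcongr)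
      _ = (a + b) ^ 2 := by field_simp; ring
  calc d2 μ ρ ≤ a + b := Real.sqrt_le_iff.2 ⟨by positivity, h'⟩
    _ = d2 μ ν + d2 ν ρ + ε := by rw [ha_def, hb_def]; ring

lemma IsP2.lintegral_nnnorm_sq (h : IsP2 μ) :
    ∫⁻ x, (‖x‖₊ : ℝ≥0∞) ^ 2 ∂μ = ENNReal.ofReal (∫ x, ‖x‖ ^ 2 ∂μ) := by
  rw [ofReal_integral_eq_lintegral_ofReal h.2 (ae_of_all _ fun x => by positivity)]
  simp only [← enorm_eq_nnnorm, ← ofReal_norm, ENNReal.ofReal_pow (norm_nonneg _)]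

lemma IsP2.d2sq_ne_top (hμ : IsP2 μ) (hν : IsP2 ν) : d2sq μ ν ≠ ⊤ := by
  have := hμ.1
  have := hν.1
  have hc : IsCoupling (μ.prod ν) μ ν :=
    .of_map (by simp) (by simp)
  refine ne_top_of_le_ne_top ?_ (hc.d2sq_le.trans
    (lintegral_mono fun p => nnnorm_sub_sq_le_weighted p.1 0 p.2 one_pos one_pos))
  rw [lintegral_add_left (by fun_prop), lintegral_const_mul _ (by fun_prop),
    lintegral_const_mul _ (by fun_prop)]
  simp only [sub_zero, zero_sub, nnnorm_neg]
  have e₁ := lintegral_map (μ := μ.prod ν) (f := fun x : Ed d => (‖x‖₊ : ℝ≥0∞) ^ 2)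
    (by fun_prop) measurable_fst
  have e₂ := lintegral_map (μ := μ.prod ν) (f := fun x : Ed d => (‖x‖₊ : ℝ≥0∞) ^ 2)
    (by fun_prop) measurable_snd
  rw [hc.2.1, hμ.lintegral_nnnorm_sq] at e₁
  rw [hc.2.2, hν.lintegral_nnnorm_sq] at e₂
  rw [← e₁, ← e₂]
  finiteness

lemma isP2_dirac (x : Ed d) : IsP2 (Measure.dirac x) :=
  ⟨inferInstance, integrable_dirac (by finiteness)⟩

lemma M2_le_d2_dirac_zero (hμ : IsP2 μ) : M2 μ ≤ d2 μ (Measure.dirac 0) := by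
  refine Real.sqrt_le_sqrt (ENNReal.ofReal_le_iff_le_toReal
    (hμ.d2sq_ne_top (isP2_dirac 0)) |>.1 ?_)
  rw [← hμ.lintegral_nnnorm_sq]
  refine le_iInf₂ fun π hπ => ?_
  rw [← hπ.2.1, lintegral_map (by fun_prop) measurable_fst]
  refine lintegral_mono_ae ?_
  have h0 : ∀ᵐ y ∂(π.map Prod.snd), y = 0 := by
    rw [hπ.2.2, ae_dirac_eq]; rfl
  filter_upwards [ae_of_ae_map measurable_snd.aemeasurable h0] with p hp
  simp [hp]

end Coupling

section Empirical

variable {d N : ℕ}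

lemma isProbabilityMeasure_empMeas (hN : N ≠ 0) (x : Fin N → Ed d) :
    IsProbabilityMeasure (empMeas x) := by
  refine ⟨?_⟩
  have h : (N : ℝ≥0∞) ≠ 0 := by exact_mod_cast hN
  simp [empMeas, ENNReal.inv_mul_cancel h (ENNReal.natCast_ne_top N)]

lemma isP2_empMeas (hN : N ≠ 0) (x : Fin N → Ed d) : IsP2 (empMeas x) := by
  refine ⟨isProbabilityMeasure_empMeas hN x, Integrable.smul_measure ?_ (by simp [hN])⟩
  exact integrable_finsetSum_measure.2 fun i _ => integrable_dirac (by finiteness)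

lemma empMeas_comp_perm (x : Fin N → Ed d) (σ : Equiv.Perm (Fin N)) :
    empMeas (fun i => x (σ i)) = empMeas x := by
  rw [empMeas, empMeas, Equiv.sum_comp σ fun i => Measure.dirac (x i)]

lemma d2sq_empMeas_le (hN : N ≠ 0) (x y : Fin N → Ed d) :
    (d2sq (empMeas x) (empMeas y)).toReal ≤ (N : ℝ)⁻¹ * ∑ i, ‖x i - y i‖ ^ 2 := by
  have := isProbabilityMeasure_empMeas hN x
  set π : Measure (Ed d × Ed d) := (N : ℝ≥0∞)⁻¹ • ∑ i, Measure.dirac (x i, y i) with hπ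
  have hc : IsCoupling π (empMeas x) (empMeas y) := by
    refine .of_map ?_ ?_ <;>
    · rw [hπ, Measure.map_smul, Measure.map_finset_sum (by fun_prop)]
      simp [empMeas, measurable_fst, measurable_snd]
  refine ENNReal.toReal_le_of_le_ofReal (by positivity) (hc.d2sq_le.trans_eq ?_)
  rw [hπ, lintegral_smul_measure, lintegral_finsetSum_measure,
    ENNReal.ofReal_mul (by positivity), ENNReal.ofReal_inv_of_pos (by positivity),
    ENNReal.ofReal_natCast, ENNReal.ofReal_sum_of_nonneg (fun i _ => by positivity)]
  simp [← enorm_eq_nnnorm, ← ofReal_norm, ENNReal.ofReal_pow]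

lemma sum_div_card_fiber {ι α : Type*} [Fintype ι] [DecidableEq α] (z : ι → α) (f : α → ℝ) :
    ∑ j, f (z j) / (Finset.univ.filter fun k => z k = z j).card
      = ∑ v ∈ Finset.univ.image z, f v := by
  rw [Finset.sum_comp (fun v => f v / (Finset.univ.filter fun k => z k = v).card) z]
  refine Finset.sum_congr rfl fun v hv => ?_
  have : ((Finset.univ.filter fun k => z k = v).card : ℝ) ≠ 0 := by
    obtain ⟨j, -, hj⟩ := Finset.mem_image.1 hv
    exact_mod_cast Finset.card_ne_zero_of_mem (Finset.mem_filter.2 ⟨Finset.mem_univ j, hj⟩)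
  rw [nsmul_eq_mul]
  field_simp

open Classical in
lemma empMeas_real_singleton (x : Fin N → Ed d) (v : Ed d) :
    (empMeas x).real {v} = (N : ℝ)⁻¹ * (Finset.univ.filter fun k => x k = v).card := by
  simp [Measure.real, empMeas, Set.indicator_apply, Finset.sum_boole, ENNReal.toReal_mul]

open Classical in
lemma IsCoupling.sum_image_snd_real {μ : Measure (Ed d)} {π : Measure (Ed d × Ed d)}
    {z : Fin N → Ed d} (h : IsCoupling π μ (empMeas z)) (u : Ed d) :
    ∑ v ∈ Finset.univ.image z, π.real {(u, v)} = μ.real {u} := by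
  have := h.1
  have hz : ∀ᵐ y ∂(π.map Prod.snd), y ∈ (Finset.univ.image z : Set (Ed d)) := by
    rw [h.2.2, ae_iff]
    simp [empMeas]
  have hae := ae_of_ae_map measurable_snd.aemeasurable hz
  rw [← h.2.1, map_measureReal_apply measurable_fst (measurableSet_singleton u)]
  have hmap := Finset.sum_map (Finset.univ.image z) (Function.Embedding.sectR u (Ed d))
    (fun q => π.real {q})
  rw [sum_measureReal_singleton] at hmap
  refine hmap.symm.trans ?_
  refine measureReal_congr (eventuallyEq_set.2 ?_)
  filter_upwards [hae] with p hp
  rw [Set.mem_preimage, Set.mem_singleton_iff]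
  obtain ⟨p₁, p₂⟩ := p
  simp only [Finset.coe_image, Finset.coe_univ, Set.image_univ, Set.mem_range] at hp
  simp only [Finset.coe_map, Finset.coe_image, Finset.coe_univ, Set.image_univ, Set.mem_image,
    Set.mem_range, Function.Embedding.sectR_apply, Prod.mk.injEq]
  constructor
  · rintro ⟨w, -, rfl, -⟩; rfl
  · rintro rfl; exact ⟨p₂, hp, rfl, rfl⟩

open Classical in
lemma exists_perm_sum_le_of_doublyStochastic {ι : Type*} [Fintype ι] {M : Matrix ι ι ℝ}
    (hM : M ∈ doublyStochastic ℝ ι) (c : ι → ι → ℝ) :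
    ∃ σ : Equiv.Perm ι, ∑ i, c i (σ i) ≤ ∑ i, ∑ j, M i j * c i j := by
  obtain ⟨w, hw, hw1, rfl⟩ := exists_eq_sum_perm_of_mem_doublyStochastic hM
  have key : ∑ i, ∑ j, (∑ σ, w σ • σ.permMatrix ℝ) i j * c i j
      = ∑ σ, w σ * ∑ i, c i (σ i) := by
    simp only [Matrix.sum_apply, Matrix.smul_apply, Finset.sum_mul, smul_eq_mul, mul_assoc,
      Finset.mul_sum]
    rw [Finset.sum_congr rfl fun i _ => Finset.sum_comm, Finset.sum_comm]
    refine Finset.sum_congr rfl fun σ _ => Finset.sum_congr rfl fun i _ => ?_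
    simp [Equiv.Perm.permMatrix, PEquiv.toMatrix_apply]
  by_contra! H
  rw [key] at H
  have : ∑ σ, w σ * ∑ σ', w σ' * ∑ i, c i (σ' i) < ∑ σ, w σ * ∑ i, c i (σ i) := by
    obtain ⟨σ, -, hσ⟩ := Finset.exists_ne_zero_of_sum_ne_zero (hw1.trans_ne one_ne_zero)
    refine Finset.sum_lt_sum (fun σ _ => mul_le_mul_of_nonneg_left (H σ).le (hw σ))
      ⟨σ, Finset.mem_univ _, mul_lt_mul_of_pos_left (H σ) ((hw σ).lt_of_ne' hσ)⟩
  rw [← Finset.sum_mul, hw1, one_mul] at this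
  exact this.false

open Classical in
lemma exists_perm_ofReal_sum_le (hN : N ≠ 0) (x z : Fin N → Ed d)
    {π : Measure (Ed d × Ed d)} (h : IsCoupling π (empMeas x) (empMeas z)) :
    ∃ σ : Equiv.Perm (Fin N), ENNReal.ofReal ((N : ℝ)⁻¹ * ∑ i, ‖x i - z (σ i)‖ ^ 2)
      ≤ ∫⁻ p, (‖p.1 - p.2‖₊ : ℝ≥0∞) ^ 2 ∂π := by
  have := h.1
  have hN' : (N : ℝ) ≠ 0 := by exact_mod_cast hN
  let a : Fin N → ℝ := fun i => (Finset.univ.filter fun k => x k = x i).card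
  let b : Fin N → ℝ := fun i => (Finset.univ.filter fun k => z k = z i).card
  have ha : ∀ i, a i ≠ 0 := fun i => Nat.cast_ne_zero.2
    (Finset.card_ne_zero_of_mem (Finset.mem_filter.2 ⟨Finset.mem_univ i, rfl⟩))
  have hb : ∀ i, b i ≠ 0 := fun i => Nat.cast_ne_zero.2
    (Finset.card_ne_zero_of_mem (Finset.mem_filter.2 ⟨Finset.mem_univ i, rfl⟩))
  let M : Matrix (Fin N) (Fin N) ℝ := fun i j => N * (π.real {(x i, z j)} / b j / a i)
  have hM : M ∈ doublyStochastic ℝ (Fin N) := by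
    rw [mem_doublyStochastic_iff_sum]
    refine ⟨fun i j => by positivity, fun i => ?_, fun j => ?_⟩
    · simp only [M]
      rw [← Finset.mul_sum, ← Finset.sum_div, sum_div_card_fiber z fun v => π.real {(x i, v)},
        h.sum_image_snd_real, empMeas_real_singleton]
      have := ha i
      simp only [a] at this ⊢
      field_simp
    · have hs := h.swap.sum_image_snd_real (z j)
      have he : ∀ u, (π.map Prod.swap).real {(z j, u)} = π.real {(u, z j)} := fun u => by
        rw [map_measureReal_apply measurable_swap (measurableSet_singleton _)]
        congr 1
        ext ⟨p, q⟩
        simp [and_comm]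
      simp only [he] at hs
      simp only [M, div_right_comm _ (b j)]
      rw [← Finset.mul_sum, ← Finset.sum_div, sum_div_card_fiber x fun u => π.real {(u, z j)},
        hs, empMeas_real_singleton]
      have := hb j
      simp only [b] at this ⊢
      field_simp
  obtain ⟨σ, hσ⟩ := exists_perm_sum_le_of_doublyStochastic hM fun i j => ‖x i - z j‖ ^ 2
  refine ⟨σ, ?_⟩
  have hsum : ∑ i, ∑ j, M i j * ‖x i - z j‖ ^ 2 = N * ∑ u ∈ Finset.univ.image x,
      ∑ v ∈ Finset.univ.image z, π.real {(u, v)} * ‖u - v‖ ^ 2 := by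
    rw [← sum_div_card_fiber x, Finset.mul_sum]
    refine Finset.sum_congr rfl fun i _ => ?_
    rw [← sum_div_card_fiber z, Finset.sum_div, Finset.mul_sum]
    refine Finset.sum_congr rfl fun j _ => ?_
    simp only [M, a, b]
    ring
  rw [hsum, ← Finset.sum_product'] at hσ
  calc ENNReal.ofReal ((N : ℝ)⁻¹ * ∑ i, ‖x i - z (σ i)‖ ^ 2)
      ≤ ENNReal.ofReal (∑ q ∈ Finset.univ.image x ×ˢ Finset.univ.image z,
          π.real {(q.1, q.2)} * ‖q.1 - q.2‖ ^ 2) := by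
        refine ENNReal.ofReal_le_ofReal ?_
        rwa [inv_mul_le_iff₀ (by positivity)]
    _ = ∫⁻ p in (Finset.univ.image x ×ˢ Finset.univ.image z : Finset (Ed d × Ed d)),
          (‖p.1 - p.2‖₊ : ℝ≥0∞) ^ 2 ∂π := by
        rw [lintegral_finset, ENNReal.ofReal_sum_of_nonneg fun _ _ => by positivity]
        refine Finset.sum_congr rfl fun q _ => ?_
        rw [mul_comm, ENNReal.ofReal_mul (by positivity), ofReal_measureReal,
          ENNReal.ofReal_pow (norm_nonneg _), ofReal_norm, enorm_eq_nnnorm]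
    _ ≤ _ := setLIntegral_le_lintegral _ _

/-- The optimal transport between two empirical measures with equally many atoms is realised by
a permutation of the atoms. -/
lemma exists_perm_sum_le_d2sq (hN : N ≠ 0) (x z : Fin N → Ed d) :
    ∃ σ : Equiv.Perm (Fin N), (N : ℝ)⁻¹ * ∑ i, ‖x i - z (σ i)‖ ^ 2
      ≤ (d2sq (empMeas x) (empMeas z)).toReal := by
  obtain ⟨σ, hσ⟩ := Finite.exists_min fun σ : Equiv.Perm (Fin N) =>
    (N : ℝ)⁻¹ * ∑ i, ‖x i - z (σ i)‖ ^ 2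
  refine ⟨σ, (ENNReal.ofReal_le_iff_le_toReal
    ((isP2_empMeas hN x).d2sq_ne_top (isP2_empMeas hN z))).1 (le_iInf₂ fun π hπ => ?_)⟩
  obtain ⟨τ, hτ⟩ := exists_perm_ofReal_sum_le hN x z hπ
  exact (ENNReal.ofReal_le_ofReal (hσ τ)).trans hτ

end Empirical

section Approximation

variable {d : ℕ} {μ ν : Measure (Ed d)}

lemma d2_le_of_d2sq_le {r : ℝ} (hr : 0 ≤ r) (h : d2sq μ ν ≤ ENNReal.ofReal (r ^ 2)) :
    d2 μ ν ≤ r :=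
  Real.sqrt_le_iff.2 ⟨hr, ENNReal.toReal_le_of_le_ofReal (by positivity) h⟩

lemma exists_empMeas_eq {ι : Type*} [Fintype ι] {N : ℕ} (z : ι → Ed d) (n : ι → ℕ)
    (hn : ∑ k, n k ≤ N) :
    ∃ y : Fin N → Ed d, empMeas y = (N : ℝ≥0∞)⁻¹ •
      (∑ k, (n k : ℝ≥0∞) • Measure.dirac (z k)
        + ((N - ∑ k, n k : ℕ) : ℝ≥0∞) • Measure.dirac 0) := by
  have e : ((Σ k, Fin (n k)) ⊕ Fin (N - ∑ k, n k)) ≃ Fin N :=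
    Fintype.equivFinOfCardEq (by simp [hn])
  refine ⟨fun i => Sum.elim (fun s => z s.1) (fun _ => 0) (e.symm i), ?_⟩
  rw [empMeas, e.symm.sum_comp fun s => Measure.dirac (Sum.elim (fun s => z s.1) (fun _ => 0) s),
    Fintype.sum_sum_type, Fintype.sum_sigma]
  simp [Nat.cast_smul_eq_nsmul, -ENNReal.natCast_sub]

lemma exists_d2sq_empMeas_sum_dirac_le {ι : Type*} [Fintype ι] (z : ι → Ed d) (w : ι → ℝ≥0)
    (hw : ∑ k, w k = 1) {N : ℕ} (hN : N ≠ 0) :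
    ∃ y : Fin N → Ed d, d2sq (empMeas y) (∑ k, (w k : ℝ≥0∞) • Measure.dirac (z k))
      ≤ ENNReal.ofReal ((N : ℝ)⁻¹ * ∑ k, ‖z k‖ ^ 2) := by
  have hN' : (N : ℝ≥0) ≠ 0 := by exact_mod_cast hN
  let n : ι → ℕ := fun k => ⌊N * w k⌋₊
  have hnw : ∀ k, (n k : ℝ≥0) ≤ N * w k := fun k => Nat.floor_le zero_le
  have hn : ∑ k, n k ≤ N := by
    have : ((∑ k, n k : ℕ) : ℝ≥0) ≤ N := by
      rw [Nat.cast_sum]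
      exact (Finset.sum_le_sum fun k _ => hnw k).trans_eq (by rw [← Finset.mul_sum, hw, mul_one])
    exact_mod_cast this
  obtain ⟨y, hy⟩ := exists_empMeas_eq z n hn
  have := isProbabilityMeasure_empMeas hN y
  let r : ι → ℝ≥0 := fun k => w k - (N : ℝ≥0)⁻¹ * n k
  have hr : ∀ k, (N : ℝ≥0)⁻¹ * n k + r k = w k := fun k => by
    refine add_tsub_cancel_of_le ?_
    rw [inv_mul_le_iff₀ (by positivity)]
    exact hnw k
  have hrN : ∀ k, r k ≤ (N : ℝ≥0)⁻¹ := fun k => by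
    rw [tsub_le_iff_left, ← mul_add_one, le_inv_mul_iff₀ (by positivity)]
    exact (Nat.lt_floor_add_one _).le
  have hrsum : ∑ k, r k = (N : ℝ≥0)⁻¹ * (N - ∑ k, n k : ℕ) := by
    have h₁ : ∑ k, ((N : ℝ≥0)⁻¹ * n k + r k) = 1 := by simp only [hr, hw]
    rw [Finset.sum_add_distrib, ← Finset.mul_sum] at h₁
    have h₂ : (N : ℝ≥0)⁻¹ * (∑ k, (n k : ℝ≥0)) + (N : ℝ≥0)⁻¹ * (N - ∑ k, n k : ℕ) = 1 := by
      rw [← mul_add, ← Nat.cast_sum, ← Nat.cast_add, Nat.add_sub_cancel' hn, inv_mul_cancel₀ hN']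
    exact add_left_cancel (h₁.trans h₂.symm)
  set π : Measure (Ed d × Ed d) :=
    ∑ k, (((N : ℝ≥0)⁻¹ * n k : ℝ≥0) • Measure.dirac (z k, z k) + r k • Measure.dirac (0, z k))
    with hπ
  have hc : IsCoupling π (empMeas y) (∑ k, (w k : ℝ≥0∞) • Measure.dirac (z k)) := by
    refine .of_map ?_ ?_
    · rw [hπ, Measure.map_finset_sum (by fun_prop), hy]
      simp only [Measure.map_add _ _ measurable_fst, Measure.map_smul,
        Measure.map_dirac' measurable_fst, Finset.sum_add_distrib, ← Finset.sum_smul, hrsum,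
        smul_add, Finset.smul_sum, smul_smul]
      simp only [ENNReal.smul_def, ENNReal.coe_mul, ENNReal.coe_inv hN', ENNReal.coe_natCast]
    · rw [hπ, Measure.map_finset_sum (by fun_prop)]
      simp only [Measure.map_add _ _ measurable_snd, Measure.map_smul,
        Measure.map_dirac' measurable_snd, ← add_smul, hr]
      rfl
  refine ⟨y, hc.d2sq_le.trans ?_⟩
  rw [hπ, lintegral_finsetSum_measure, Finset.mul_sum,
    ENNReal.ofReal_sum_of_nonneg fun _ _ => by positivity]
  refine Finset.sum_le_sum fun k _ => ?_
  rw [lintegral_add_measure, ENNReal.smul_def, ENNReal.smul_def, lintegral_smul_measure,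
    lintegral_smul_measure, lintegral_dirac, lintegral_dirac, ENNReal.ofReal_mul (by positivity),
    ENNReal.ofReal_inv_of_pos (by positivity), ENNReal.ofReal_natCast,
    ENNReal.ofReal_pow (norm_nonneg _), ofReal_norm, enorm_eq_nnnorm]
  have h := ENNReal.coe_le_coe.2 (hrN k)
  rw [ENNReal.coe_inv hN', ENNReal.coe_natCast] at h
  simp only [sub_self, nnnorm_zero, zero_sub, nnnorm_neg, smul_eq_mul]
  simpa using mul_le_mul_left h _

open Classical in
lemma map_simpleFunc_eq_sum (ν : Measure (Ed d)) (g : SimpleFunc (Ed d) (Ed d)) :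
    ν.map g = ∑ k : g.range, ν (g ⁻¹' {k.1}) • Measure.dirac k.1 := by
  ext s hs
  rw [Measure.map_apply g.measurable hs]
  have h := g.sum_measure_preimage_singleton (μ := ν) (g.range.filter (· ∈ s))
  have hset : g ⁻¹' ↑(g.range.filter (· ∈ s)) = g ⁻¹' s := by
    ext x; simp
  rw [hset, Finset.sum_filter] at h
  rw [← h, ← Finset.sum_coe_sort]
  simp [hs, Set.indicator_apply]

lemma exists_empMeas_d2_lt (hν : IsP2 ν) {ε : ℝ} (hε : 0 < ε) :
    ∀ᶠ N : ℕ in atTop, ∃ y : Fin N → Ed d, d2 (empMeas y) ν < ε := by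
  have := hν.1
  have hmem : MemLp (fun x : Ed d => x) 2 ν :=
    (memLp_two_iff_integrable_sq_norm aestronglyMeasurable_id).2 hν.2
  obtain ⟨g, hg, -⟩ := hmem.exists_simpleFunc_eLpNorm_sub_lt (by simp)
    (ε := ENNReal.ofReal (ε / 2)) (by simpa using hε)
  have hcg : IsCoupling (ν.map fun x => (g x, x)) (ν.map g) ν := by
    have := Measure.isProbabilityMeasure_map (μ := ν) g.measurable.aemeasurable
    have hm : Measurable fun x => (g x, x) := g.measurable.prodMk measurable_id
    refine .of_map ?_ ?_
    · rw [Measure.map_map measurable_fst hm]; rfl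
    · rw [Measure.map_map measurable_snd hm]; exact Measure.map_id
  have hgν : d2sq (ν.map g) ν ≤ ENNReal.ofReal ((ε / 2) ^ 2) := by
    refine hcg.d2sq_le.trans ?_
    have hm : Measurable fun x => (g x, x) := g.measurable.prodMk measurable_id
    rw [lintegral_map (by fun_prop) hm,
      ENNReal.ofReal_pow (by positivity)]
    refine le_trans (le_of_eq ?_) (pow_le_pow_left₀ zero_le hg.le 2)
    have h := eLpNorm_nnreal_pow_eq_lintegral (f := (fun x : Ed d => x) - ⇑g) (μ := ν)
      (p := 2) two_ne_zero
    simp only [NNReal.coe_ofNat, ENNReal.coe_ofNat, ENNReal.rpow_ofNat] at h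
    rw [h]
    exact lintegral_congr fun x => by rw [← enorm_eq_nnnorm, enorm_sub_rev]; rfl
  let w : g.range → ℝ≥0 := fun k => (ν (g ⁻¹' {k.1})).toNNReal
  have hwν : ∀ k, (w k : ℝ≥0∞) = ν (g ⁻¹' {k.1}) := fun k =>
    ENNReal.coe_toNNReal (measure_ne_top _ _)
  have hw : ∑ k, w k = 1 := by
    have h := g.sum_range_measure_preimage_singleton ν
    rw [← Finset.sum_coe_sort, measure_univ] at h
    rw [← ENNReal.coe_inj]
    push_cast
    simpa only [hwν] using h
  have hlim : Tendsto (fun N : ℕ => (N : ℝ)⁻¹ * ∑ k : g.range, ‖k.1‖ ^ 2) atTop (nhds 0) := by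
    simpa using (tendsto_inv_atTop_nhds_zero_nat (𝕜 := ℝ)).mul_const
      (∑ k : g.range, ‖k.1‖ ^ 2)
  filter_upwards [eventually_ne_atTop 0,
    hlim.eventually_lt_const (show (0 : ℝ) < (ε / 3) ^ 2 by positivity)] with N hN hNε
  obtain ⟨y, hy⟩ := exists_d2sq_empMeas_sum_dirac_le (fun k : g.range => k.1) w hw hN
  simp only [hwν] at hy
  rw [← map_simpleFunc_eq_sum] at hy
  have hy' := hy.trans (ENNReal.ofReal_le_ofReal hNε.le)
  refine ⟨y, ?_⟩
  have h₁ := d2_le_of_d2sq_le (by positivity) hy'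
  have h₂ := d2_le_of_d2sq_le (by positivity) hgν
  have h₃ := d2_triangle (ne_top_of_le_ne_top ENNReal.ofReal_ne_top hy')
    (ne_top_of_le_ne_top ENNReal.ofReal_ne_top hgν)
  linarith

lemma exists_empMeas_tendsto (hν : IsP2 ν) :
    ∃ z : ∀ N : ℕ, Fin N → Ed d, Tendsto (fun N => d2 (empMeas (z N)) ν) atTop (nhds 0) := by
  have hbdd : ∀ N : ℕ, BddBelow (Set.range fun y : Fin N → Ed d => d2 (empMeas y) ν) :=
    fun N => ⟨0, by rintro _ ⟨y, rfl⟩; exact d2_nonneg _ _⟩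
  have h : ∀ N : ℕ, ∃ y : Fin N → Ed d, d2 (empMeas y) ν
      < (⨅ y : Fin N → Ed d, d2 (empMeas y) ν) + 1 / ((N : ℝ) + 1) := fun N =>
    exists_lt_of_ciInf_lt (lt_add_of_pos_right _ (by positivity))
  choose z hz using h
  refine ⟨z, tendsto_order.2 ⟨fun a ha => .of_forall fun N => ha.trans_le (d2_nonneg _ _),
    fun a ha => ?_⟩⟩
  filter_upwards [exists_empMeas_d2_lt hν (half_pos ha),
    (tendsto_one_div_add_atTop_nhds_zero_nat (𝕜 := ℝ)).eventually_lt_const (half_pos ha)]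
    with N ⟨y, hy⟩ hN
  have := hz N
  have := ciInf_le (hbdd N) y
  linarith

end Approximation

section HopfLax

variable {d : ℕ} {G : Measure (Ed d) → ℝ} {T t c CG : ℝ}

lemma MFval_le (hc : ∀ μ : Measure (Ed d), IsP2 μ → c ≤ G μ) (htT : t < T)
    (m : Measure (Ed d)) {ν : Measure (Ed d)} (hν : IsP2 ν) :
    MFval T G t m ≤ G ν + d2 m ν ^ 2 / (2 * (T - t)) := by
  have : 0 < T - t := sub_pos.2 htT
  rw [d2_sq]
  refine csInf_le ⟨c, ?_⟩ ⟨ν, hν, rfl⟩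
  rintro r ⟨ρ, hρ, rfl⟩
  have : 0 ≤ (d2sq m ρ).toReal / (2 * (T - t)) := by positivity
  linarith [hc ρ hρ]

lemma NPval_le (hc : ∀ μ : Measure (Ed d), IsP2 μ → c ≤ G μ) (htT : t < T)
    {N : ℕ} (hN : N ≠ 0) (x z : Fin N → Ed d) :
    NPval T G t x ≤ G (empMeas z) + d2 (empMeas x) (empMeas z) ^ 2 / (2 * (T - t)) := by
  have : 0 < T - t := sub_pos.2 htT
  obtain ⟨σ, hσ⟩ := exists_perm_sum_le_d2sq hN x z
  rw [← d2_sq] at hσ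
  calc NPval T G t x
      ≤ G (empMeas fun i => z (σ i))
          + 1 / (2 * (T - t) * (N : ℝ)) * ∑ i, ‖x i - z (σ i)‖ ^ 2 := by
        refine csInf_le ⟨c, ?_⟩ ⟨_, rfl⟩
        rintro r ⟨y, rfl⟩
        have : 0 ≤ 1 / (2 * (T - t) * (N : ℝ)) * ∑ i, ‖x i - y i‖ ^ 2 := by positivity
        linarith [hc _ (isP2_empMeas hN y)]
    _ = G (empMeas z) + ((N : ℝ)⁻¹ * ∑ i, ‖x i - z (σ i)‖ ^ 2) / (2 * (T - t)) := by
        rw [empMeas_comp_perm]; field_simp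
    _ ≤ _ := by gcongr

lemma MFval_sub_le (hc : ∀ μ : Measure (Ed d), IsP2 μ → c ≤ G μ) (htT : t < T)
    {m : Measure (Ed d)} (hm : IsP2 m) {N : ℕ} (hN : N ≠ 0) (x : Fin N → Ed d) {ε : ℝ}
    (hε : 0 < ε) :
    MFval T G t m - c ≤ (1 + ε) * (NPval T G t x - c)
      + (1 + 1 / ε) * d2 (empMeas x) m ^ 2 / (2 * (T - t)) := by
  have : 0 < T - t := sub_pos.2 htT
  have hx := isP2_empMeas hN x
  suffices c + (MFval T G t m - c
      - (1 + 1 / ε) * d2 (empMeas x) m ^ 2 / (2 * (T - t))) / (1 + ε) ≤ NPval T G t x by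
    rw [← le_sub_iff_add_le', div_le_iff₀' (by positivity)] at this
    linarith
  refine le_csInf ⟨_, 0, rfl⟩ ?_
  rintro r ⟨y, rfl⟩
  have hy := isP2_empMeas hN y
  rw [← le_sub_iff_add_le', div_le_iff₀' (by positivity)]
  have h₁ : d2 m (empMeas y) ^ 2 ≤ (1 + 1 / ε) * d2 (empMeas x) m ^ 2
      + (1 + ε) * ((N : ℝ)⁻¹ * ∑ i, ‖x i - y i‖ ^ 2) := by
    calc d2 m (empMeas y) ^ 2
        ≤ (d2 (empMeas x) m + d2 (empMeas x) (empMeas y)) ^ 2 := by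
          refine pow_le_pow_left₀ (d2_nonneg _ _) ?_ 2
          rw [d2_comm (empMeas x) m]
          exact d2_triangle (hm.d2sq_ne_top hx) (hx.d2sq_ne_top hy)
      _ ≤ (1 + 1 / ε) * d2 (empMeas x) m ^ 2
          + (1 + ε / 1) * d2 (empMeas x) (empMeas y) ^ 2 := add_sq_le_weighted _ _ hε one_pos
      _ ≤ _ := by
          rw [div_one, d2_sq (empMeas x) (empMeas y)]
          gcongr
          exact d2sq_empMeas_le hN x y
  have h₂ := div_le_div_of_nonneg_right h₁ (show 0 ≤ 2 * (T - t) by positivity)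
  have h₃ := MFval_le hc htT m hy
  have h₄ : 0 ≤ ε * (G (empMeas y) - c) := mul_nonneg hε.le (sub_nonneg.2 (hc _ hy))
  have h₅ : (1 / (2 * (T - t) * (N : ℝ))) * ∑ i, ‖x i - y i‖ ^ 2
      = ((N : ℝ)⁻¹ * ∑ i, ‖x i - y i‖ ^ 2) / (2 * (T - t)) := by field_simp
  rw [add_div, mul_div_assoc (1 + ε)] at h₂
  rw [h₅]
  linarith

lemma tendsto_of_d2_tendsto_zero
    (hGlip : ∀ μ ν : Measure (Ed d), IsP2 μ → IsP2 ν →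
      |G ν - G μ| ≤ CG * (1 + M2 μ + M2 ν) * d2 μ ν) (hCG : 0 < CG)
    {ν : Measure (Ed d)} (hν : IsP2 ν) {ρ : ℕ → Measure (Ed d)} (hρ : ∀ᶠ N in atTop, IsP2 (ρ N))
    (h : Tendsto (fun N => d2 (ρ N) ν) atTop (nhds 0)) :
    Tendsto (fun N => G (ρ N)) atTop (nhds (G ν)) := by
  have hlim : Tendsto (fun N => CG * (1 + M2 ν + (d2 (ρ N) ν + d2 ν (Measure.dirac 0)))
      * d2 (ρ N) ν) atTop (nhds 0) := by
    simpa using (((h.add_const (d2 ν (Measure.dirac 0))).const_add (1 + M2 ν)).const_mul CG).mul h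
  rw [tendsto_iff_dist_tendsto_zero]
  refine squeeze_zero' (.of_forall fun _ => dist_nonneg) ?_ hlim
  filter_upwards [hρ] with N hN
  refine (hGlip ν (ρ N) hν hN).trans ?_
  rw [d2_comm ν (ρ N)]
  have := d2_nonneg (ρ N) ν
  gcongr
  exact (M2_le_d2_dirac_zero hN).trans
    (d2_triangle (hN.d2sq_ne_top hν) (hν.d2sq_ne_top (isP2_dirac 0)))

end HopfLax

/-- convergence `V^N(t, x^N) → U(t, m)` along any sequence of empirical
measures converging to `m` in `d_2`, for `G` bounded below and locally Lipschitz wrt `d_2`. -/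
theorem nParticleVal_tendsto_mfVal {d : ℕ} (hd : 1 ≤ d)
    (T : ℝ) (hT : 0 < T)
    (G : Measure (Ed d) → ℝ)
    (hGbd : ∃ c : ℝ, ∀ μ : Measure (Ed d), IsP2 μ → c ≤ G μ)
    (CG : ℝ) (hCG : 0 < CG)
    (hGlip : ∀ μ ν : Measure (Ed d), IsP2 μ → IsP2 ν →
      |G ν - G μ| ≤ CG * (1 + M2 μ + M2 ν) * d2 μ ν)
    (t : ℝ) (ht : 0 ≤ t) (htT : t < T)
    (m : Measure (Ed d)) (hm : IsP2 m)
    (x : ∀ N : ℕ, Fin N → Ed d)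
    (hx : Tendsto (fun N : ℕ => d2 (empMeas (x N)) m) atTop (nhds 0)) :
    Tendsto (fun N : ℕ => NPval T G t (x N)) atTop (nhds (MFval T G t m)) := by
  obtain ⟨c, hc⟩ := hGbd
  have hs : 0 < T - t := sub_pos.2 htT
  refine tendsto_order.2 ⟨fun a ha => ?_, fun a ha => ?_⟩
  · set η : ℕ → ℝ := fun N => d2 (empMeas (x N)) m
    have hε : Tendsto (fun N : ℕ => η N + 1 / ((N : ℝ) + 1)) atTop (nhds 0) := by
      simpa using hx.add (tendsto_one_div_add_atTop_nhds_zero_nat (𝕜 := ℝ))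
    have hlim : Tendsto (fun N : ℕ => c + (MFval T G t m - c
        - (η N ^ 2 + η N) / (2 * (T - t))) / (1 + (η N + 1 / ((N : ℝ) + 1))))
        atTop (nhds (MFval T G t m)) := by
      have := ((((hx.pow 2).add hx).div_const (2 * (T - t))).const_sub
        (MFval T G t m - c)).div (hε.const_add 1) (by norm_num) |>.const_add c
      simpa using this
    filter_upwards [hlim.eventually_const_lt ha, eventually_ne_atTop 0] with N hNa hN
    refine hNa.trans_le ?_
    have hη : 0 ≤ η N := d2_nonneg _ _
    have hN1 : 0 < 1 / ((N : ℝ) + 1) := by positivity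
    have hpos : 0 < η N + 1 / ((N : ℝ) + 1) := by positivity
    rw [← le_sub_iff_add_le', div_le_iff₀' (by positivity), sub_le_iff_le_add]
    refine (MFval_sub_le hc htT hm hN (x N) hpos).trans ?_
    gcongr
    rw [add_mul, one_mul]
    refine add_le_add le_rfl ?_
    rw [one_div_mul_eq_div, div_le_iff₀ hpos]
    change η N ^ 2 ≤ _
    nlinarith
  · obtain ⟨_, ⟨ν, hν, rfl⟩, hνa⟩ := exists_lt_of_csInf_lt (by exact ⟨_, m, hm, rfl⟩) ha
    obtain ⟨z, hz⟩ := exists_empMeas_tendsto hν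
    have hP2 : ∀ᶠ N : ℕ in atTop, IsP2 (empMeas (z N)) := by
      filter_upwards [eventually_ne_atTop 0] with N hN using isP2_empMeas hN _
    have hlim : Tendsto (fun N : ℕ => G (empMeas (z N))
        + (d2 (empMeas (x N)) m + d2 m ν + d2 (empMeas (z N)) ν) ^ 2 / (2 * (T - t)))
        atTop (nhds (G ν + (d2sq m ν).toReal / (2 * (T - t)))) := by
      have := (tendsto_of_d2_tendsto_zero hGlip hCG hν hP2 hz).add
        ((((hx.add_const (d2 m ν)).add hz).pow 2).div_const (2 * (T - t)))
      simpa [d2_sq] using this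
    filter_upwards [hlim.eventually_lt_const hνa, eventually_ne_atTop 0] with N hNa hN
    have hxN := isP2_empMeas hN (x N)
    have hzN := isP2_empMeas hN (z N)
    refine (NPval_le hc htT hN (x N) (z N)).trans_lt (lt_of_le_of_lt ?_ hNa)
    gcongr
    · exact d2_nonneg _ _
    · refine (d2_triangle (hxN.d2sq_ne_top hν) (hν.d2sq_ne_top hzN)).trans ?_
      rw [d2_comm ν]
      gcongr
      exact d2_triangle (hxN.d2sq_ne_top hm) (hm.d2sq_ne_top hν)

end
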